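/- (Linear convergence of natural gradient descent.) Let K₀ ∈ S and define iterates K_{j+1} = K_j − 2 η_j M(K_j) with the stepsize η_j = 1 / ( 2 λ_n( R + Bᵀ X(K_j) B ) ). Then every K_j is Schur-stabilizing, X(K_{j+1}) ⪯ X(K_j), and there exist constants q₀ ∈ (0,1) and c₂ > 0 (depending only on A, B, Q, R, Σ, K₀) such that for all j: f(K_j) − f(K_*) ≤ q₀^j ( f(K₀) − f(K_*) ) and ‖K_j − K_*‖_F ≤ c₂ q₀^{j/2}. -/

import Mathlib

open Matrix

/-- `M` is Schur stable: spectral radius `ρ(M) < 1`. -/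
def IsSchur {k : ℕ} (M : Matrix (Fin k) (Fin k) ℝ) : Prop :=
  ∀ μ ∈ spectrum ℂ (M.map (Complex.ofReal ·)), ‖μ‖ < 1

/-- The largest eigenvalue `λ_n` of a (symmetric) real matrix. -/
noncomputable def eigMax {k : ℕ} (M : Matrix (Fin k) (Fin k) ℝ) : ℝ :=
  sSup (spectrum ℝ M)

/-- The Frobenius norm of a real matrix. -/
noncomputable def frobNorm {a b : ℕ} (K : Matrix (Fin a) (Fin b) ℝ) : ℝ :=
  Real.sqrt (∑ i, ∑ j, (K i j) ^ 2)

open Filter Topology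

open scoped MatrixOrder in
theorem Matrix.PosSemidef.trace_mul_nonneg {k : ℕ} {P T : Matrix (Fin k) (Fin k) ℝ}
    (hP : P.PosSemidef) (hT : T.PosSemidef) : 0 ≤ (P * T).trace := by
  obtain ⟨C, rfl⟩ := CStarAlgebra.nonneg_iff_eq_star_mul_self.mp hT.nonneg
  rw [Matrix.star_eq_conjTranspose, ← Matrix.mul_assoc, Matrix.trace_mul_comm, ← Matrix.mul_assoc]
  exact (hP.mul_mul_conjTranspose_same C).trace_nonneg

theorem Matrix.PosSemidef.transpose_mul_mul_same {a b : ℕ} {P : Matrix (Fin a) (Fin a) ℝ}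
    (hP : P.PosSemidef) (C : Matrix (Fin a) (Fin b) ℝ) : (Cᵀ * P * C).PosSemidef := by
  simpa using hP.conjTranspose_mul_mul_same C

theorem Matrix.posSemidef_transpose_mul_self {a b : ℕ} (C : Matrix (Fin a) (Fin b) ℝ) :
    (Cᵀ * C).PosSemidef := by
  simpa using Matrix.posSemidef_conjTranspose_mul_self C

theorem le_eigMax {k : ℕ} (S : Matrix (Fin k) (Fin k) ℝ) {x : ℝ} (hx : x ∈ spectrum ℝ S) :
    x ≤ eigMax S :=
  le_csSup Matrix.finite_real_spectrum.bddAbove hx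

open scoped MatrixOrder in
theorem posSemidef_smul_one_sub {k : ℕ} {S : Matrix (Fin k) (Fin k) ℝ} (hS : S.IsHermitian)
    {c : ℝ} (hc : ∀ x ∈ spectrum ℝ S, x ≤ c) : (c • 1 - S).PosSemidef := by
  have h : S ≤ algebraMap ℝ _ c := le_algebraMap_of_spectrum_le hc hS
  rwa [Matrix.le_iff, Algebra.algebraMap_eq_smul_one] at h

theorem le_of_mem_spectrum_of_posSemidef {k : ℕ} {S : Matrix (Fin k) (Fin k) ℝ} (hS : S.IsHermitian)
    {c : ℝ} (h : (c • 1 - S).PosSemidef) {x : ℝ} (hx : x ∈ spectrum ℝ S) : x ≤ c := by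
  rw [hS.spectrum_real_eq_range_eigenvalues] at hx
  obtain ⟨i, rfl⟩ := hx
  have h1 := h.dotProduct_mulVec_nonneg (hS.eigenvectorBasis i)
  have h2 : hS.eigenvectorBasis i ≠ 0 := hS.eigenvectorBasis.orthonormal.ne_zero i
  have h3 : 0 < star (⇑(hS.eigenvectorBasis i)) ⬝ᵥ ⇑(hS.eigenvectorBasis i) := by
    rw [Matrix.dotProduct_star_self_pos_iff]
    intro h
    apply h2
    ext j
    exact congrFun h j
  rw [Matrix.sub_mulVec, hS.mulVec_eigenvectorBasis, Matrix.smul_mulVec, Matrix.one_mulVec,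
    dotProduct_sub, dotProduct_smul, dotProduct_smul, smul_eq_mul, smul_eq_mul, ← sub_mul] at h1
  linarith [nonneg_of_mul_nonneg_left h1 h3]

theorem posSemidef_eigMax_smul_one_sub {k : ℕ} {S : Matrix (Fin k) (Fin k) ℝ}
    (hS : S.IsHermitian) : (eigMax S • 1 - S).PosSemidef :=
  posSemidef_smul_one_sub hS fun _ => le_eigMax S

theorem spectrum_nonempty_of_isHermitian {k : ℕ} (hk : 0 < k) {S : Matrix (Fin k) (Fin k) ℝ}
    (hS : S.IsHermitian) : (spectrum ℝ S).Nonempty := by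
  rw [hS.spectrum_real_eq_range_eigenvalues]
  exact ⟨_, ⟨0, hk⟩, rfl⟩

theorem eigMax_pos {k : ℕ} (hk : 0 < k) {S : Matrix (Fin k) (Fin k) ℝ} (hS : S.PosDef) :
    0 < eigMax S := by
  refine lt_of_lt_of_le (hS.eigenvalues_pos ⟨0, hk⟩) (le_eigMax S ?_)
  rw [hS.1.spectrum_real_eq_range_eigenvalues]
  exact ⟨_, rfl⟩

theorem eigMax_mono {k : ℕ} (hk : 0 < k) {S T : Matrix (Fin k) (Fin k) ℝ} (hS : S.IsHermitian)
    (hT : T.IsHermitian) (h : (T - S).PosSemidef) : eigMax S ≤ eigMax T := by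
  refine csSup_le (spectrum_nonempty_of_isHermitian hk hS) fun x hx =>
    le_of_mem_spectrum_of_posSemidef hS ?_ hx
  simpa using (posSemidef_eigMax_smul_one_sub hT).add h

theorem Matrix.PosDef.exists_smul_one_le {k : ℕ} {P : Matrix (Fin k) (Fin k) ℝ} (hP : P.PosDef) :
    ∃ c > (0 : ℝ), (P - c • (1 : Matrix (Fin k) (Fin k) ℝ)).PosSemidef := by
  have h : ∃ c > 0, ∀ i, c ≤ hP.1.eigenvalues i := by
    obtain hk | hk := isEmpty_or_nonempty (Fin k)
    · exact ⟨1, one_pos, fun i => hk.elim i⟩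
    · obtain ⟨i, hi⟩ := Finite.exists_min hP.1.eigenvalues
      exact ⟨_, hP.eigenvalues_pos i, hi⟩
  obtain ⟨c, hc, hi⟩ := h
  refine ⟨c, hc, ?_⟩
  have := posSemidef_smul_one_sub (S := -P) hP.1.neg (c := -c) ?_
  · convert this using 1
    module
  · intro x hx
    rw [← spectrum.neg_eq, Set.mem_neg, hP.1.spectrum_real_eq_range_eigenvalues] at hx
    obtain ⟨i, h⟩ := hx
    linarith [hi i]

theorem Matrix.PosDef.exists_le_smul {k : ℕ} {P H : Matrix (Fin k) (Fin k) ℝ} (hP : P.PosDef)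
    (hH : H.IsHermitian) : ∃ c > (0 : ℝ), (c • P - H).PosSemidef := by
  obtain ⟨d, hd, hPd⟩ := hP.exists_smul_one_le
  have h1 := posSemidef_smul_one_sub hH (c := |eigMax H| + 1)
    fun x hx => (le_eigMax H hx).trans ((le_abs_self _).trans (by linarith))
  have hpos : 0 < (|eigMax H| + 1) / d := by positivity
  refine ⟨_, hpos, ?_⟩
  convert (hPd.smul hpos.le).add h1 using 1
  rw [smul_sub, smul_smul, div_mul_cancel₀ _ hd.ne']
  abel

attribute [local instance] Matrix.linftyOpNormedRing Matrix.linftyOpNormedAlgebra in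
theorem tendsto_pow_of_spectrum_lt {k : ℕ} (a : Matrix (Fin k) (Fin k) ℂ)
    (h : ∀ μ ∈ spectrum ℂ a, ‖μ‖ < 1) : Tendsto (fun i : ℕ => a ^ i) atTop (𝓝 0) := by
  obtain hk | hk := isEmpty_or_nonempty (Fin k)
  · exact tendsto_const_nhds.congr fun i => Subsingleton.elim _ _
  have h1 : spectralRadius ℂ a < (1 : NNReal) := spectrum.spectralRadius_lt_of_forall_lt a h
  obtain ⟨r, hr, hr1⟩ := ENNReal.lt_iff_exists_nnreal_btwn.mp h1
  have h2 := spectrum.pow_nnnorm_pow_one_div_tendsto_nhds_spectralRadius a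
  have h3 : ∀ᶠ i : ℕ in atTop, ‖a ^ i‖ ≤ (r : ℝ) ^ i := by
    filter_upwards [h2.eventually_lt_const hr, eventually_gt_atTop 0] with i hi hi0
    have h4 : (‖a ^ i‖₊ : ENNReal) ≤ (r : ENNReal) ^ i := by
      have := ENNReal.rpow_le_rpow hi.le (Nat.cast_nonneg (α := ℝ) i)
      rwa [← ENNReal.rpow_mul, one_div_mul_cancel (by positivity), ENNReal.rpow_one,
        ENNReal.rpow_natCast] at this
    exact_mod_cast h4
  exact squeeze_zero_norm' h3 (tendsto_pow_atTop_nhds_zero_of_lt_one r.2 (by exact_mod_cast hr1))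

theorem IsSchur.tendsto_pow {k : ℕ} {L : Matrix (Fin k) (Fin k) ℝ} (hL : IsSchur L) :
    Tendsto (fun i : ℕ => L ^ i) atTop (𝓝 0) := by
  have h := tendsto_pow_of_spectrum_lt _ hL
  have h1 : ∀ i : ℕ, L ^ i = ((L.map (Complex.ofReal ·)) ^ i).map Complex.re := by
    intro i
    have : (L.map (Complex.ofReal ·)) ^ i = (L ^ i).map (Complex.ofReal ·) :=
      (map_pow (Complex.ofRealHom.mapMatrix) L i).symm
    rw [this]
    ext
    simp
  simp_rw [h1]
  have := (Continuous.matrix_map continuous_id Complex.continuous_re).tendsto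
    (0 : Matrix (Fin k) (Fin k) ℂ) |>.comp h
  simpa [Function.comp_def] using this

theorem Matrix.PosDef.transpose_eq {k : ℕ} {P : Matrix (Fin k) (Fin k) ℝ} (hP : P.PosDef) :
    Pᵀ = P := by
  simpa using hP.1.eq

theorem exists_mulVec_of_mem_spectrum {k : ℕ} {L : Matrix (Fin k) (Fin k) ℝ} {μ : ℂ}
    (hμ : μ ∈ spectrum ℂ (L.map (Complex.ofReal ·))) :
    ∃ x y : Fin k → ℝ, (x ≠ 0 ∨ y ≠ 0) ∧ L *ᵥ x = μ.re • x - μ.im • y ∧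
      L *ᵥ y = μ.im • x + μ.re • y := by
  rw [← Matrix.spectrum_toLin', ← Module.End.hasEigenvalue_iff_mem_spectrum] at hμ
  obtain ⟨v, hv⟩ := hμ.exists_hasEigenvector
  have hv1 : L.map (Complex.ofReal ·) *ᵥ v = μ • v := by simpa using hv.apply_eq_smul
  refine ⟨fun i => (v i).re, fun i => (v i).im, ?_, ?_, ?_⟩
  · by_contra! h
    refine hv.2 (funext fun i => Complex.ext (congrFun h.1 i) (congrFun h.2 i))
  · funext i
    simpa [Matrix.mulVec, dotProduct] using congrArg Complex.re (congrFun hv1 i)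
  · funext i
    have := congrArg Complex.im (congrFun hv1 i)
    simp only [mulVec, dotProduct, map_apply, Complex.im_sum, Pi.smul_apply,
      smul_eq_mul, Complex.mul_im, Pi.add_apply, Complex.ofReal_re,
      Complex.ofReal_im, zero_mul, add_zero] at this ⊢
    linarith

theorem isSchur_of_lyapunov {k : ℕ} {L P : Matrix (Fin k) (Fin k) ℝ} (hP : P.PosSemidef)
    (h : (P - Lᵀ * P * L).PosDef) : IsSchur L := by
  intro μ hμ
  obtain ⟨x, y, hxy, hx, hy⟩ := exists_mulVec_of_mem_spectrum hμ
  have key : ∀ z, z ⬝ᵥ (P - Lᵀ * P * L) *ᵥ z = z ⬝ᵥ P *ᵥ z - (L *ᵥ z) ⬝ᵥ P *ᵥ (L *ᵥ z) := by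
    intro z
    rw [Matrix.sub_mulVec, dotProduct_sub, ← Matrix.mulVec_mulVec, ← Matrix.mulVec_mulVec,
      Matrix.dotProduct_mulVec z Lᵀ, Matrix.vecMul_transpose]
  have hnn : ∀ z, 0 ≤ z ⬝ᵥ P *ᵥ z := fun z => by simpa using hP.dotProduct_mulVec_nonneg z
  have hnn' : ∀ z, 0 ≤ z ⬝ᵥ (P - Lᵀ * P * L) *ᵥ z := fun z => by
    simpa using h.posSemidef.dotProduct_mulVec_nonneg z
  have hpos : ∀ z, z ≠ 0 → 0 < z ⬝ᵥ (P - Lᵀ * P * L) *ᵥ z := fun z hz => by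
    simpa using h.dotProduct_mulVec_pos hz
  have hsum : 0 < x ⬝ᵥ (P - Lᵀ * P * L) *ᵥ x + y ⬝ᵥ (P - Lᵀ * P * L) *ᵥ y := by
    rcases hxy with h0 | h0
    · linarith [hpos x h0, hnn' y]
    · linarith [hpos y h0, hnn' x]
  rw [key, key, hx, hy] at hsum
  simp only [Matrix.mulVec_add, Matrix.mulVec_sub, Matrix.mulVec_smul, dotProduct_add,
    dotProduct_sub, add_dotProduct, sub_dotProduct, dotProduct_smul, smul_dotProduct,
    smul_eq_mul] at hsum
  have hsq : ‖μ‖ ^ 2 = μ.re ^ 2 + μ.im ^ 2 := by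
    rw [Complex.sq_norm, Complex.normSq_apply]; ring
  by_contra! hge
  have h1 : 1 ≤ μ.re ^ 2 + μ.im ^ 2 := by nlinarith
  nlinarith [mul_nonneg (sub_nonneg.mpr h1) (add_nonneg (hnn x) (hnn y))]

theorem posSemidef_of_tendsto {k : ℕ} {F : ℕ → Matrix (Fin k) (Fin k) ℝ}
    {D : Matrix (Fin k) (Fin k) ℝ} (hF : Tendsto F atTop (𝓝 D)) (h : ∀ i, (F i).PosSemidef) :
    D.PosSemidef := by
  refine .of_dotProduct_mulVec_nonneg ?_ fun x => ?_
  · have h1 := (continuous_id.matrix_conjTranspose.tendsto D).comp hF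
    exact tendsto_nhds_unique (h1.congr fun i => (h i).1) hF
  · have h1 := ((continuous_const (y := star x)).dotProduct
      (continuous_id.matrix_mulVec (continuous_const (y := x)))).tendsto D |>.comp hF
    exact ge_of_tendsto' h1 fun i => (h i).dotProduct_mulVec_nonneg x

/-- A solution of the Stein equation with stable coefficient and positive semidefinite
right-hand side is positive semidefinite. -/
theorem posSemidef_of_stein {k : ℕ} {L D W : Matrix (Fin k) (Fin k) ℝ}
    (hL : Tendsto (fun i : ℕ => L ^ i) atTop (𝓝 0)) (hD : Lᵀ * D * L + W = D)
    (hW : W.PosSemidef) : D.PosSemidef := by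
  have h1 : ∀ i : ℕ, (D - (L ^ i)ᵀ * D * L ^ i).PosSemidef := by
    intro i
    induction i with
    | zero => simpa using Matrix.PosSemidef.zero
    | succ i ih =>
      convert hW.add (ih.transpose_mul_mul_same L) using 1
      nth_rewrite 1 [← hD]
      rw [pow_succ, Matrix.transpose_mul]
      noncomm_ring
  refine posSemidef_of_tendsto ?_ h1
  have h2 := ((continuous_const (y := D)).sub ((continuous_id.matrix_transpose.matrix_mul
    (continuous_const (y := D))).matrix_mul continuous_id)).tendsto
      (0 : Matrix (Fin k) (Fin k) ℝ) |>.comp hL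
  simpa [Function.comp_def] using h2

section LQR

variable {n m : ℕ} {A Q : Matrix (Fin n) (Fin n) ℝ} {B : Matrix (Fin n) (Fin m) ℝ}
  {R : Matrix (Fin m) (Fin m) ℝ}

/-- `P` solves the Lyapunov equation of the feedback gain `K`. -/
def IsCostMatrix (A Q : Matrix (Fin n) (Fin n) ℝ) (B : Matrix (Fin n) (Fin m) ℝ)
    (R : Matrix (Fin m) (Fin m) ℝ) (K : Matrix (Fin m) (Fin n) ℝ)
    (P : Matrix (Fin n) (Fin n) ℝ) : Prop :=
  (A - B * K)ᵀ * P * (A - B * K) + Kᵀ * R * K + Q = P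

/-- Half of the natural gradient of the LQR cost. -/
def natGrad (A : Matrix (Fin n) (Fin n) ℝ) (B : Matrix (Fin n) (Fin m) ℝ)
    (R : Matrix (Fin m) (Fin m) ℝ) (K : Matrix (Fin m) (Fin n) ℝ)
    (P : Matrix (Fin n) (Fin n) ℝ) : Matrix (Fin m) (Fin n) ℝ :=
  R * K - Bᵀ * P * (A - B * K)

variable {K K' : Matrix (Fin m) (Fin n) ℝ} {P P' : Matrix (Fin n) (Fin n) ℝ}

theorem IsCostMatrix.posDef (hQ : Q.PosDef) (hR : R.PosDef) (hK : IsSchur (A - B * K))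
    (hP : IsCostMatrix A Q B R K P) : P.PosDef := by
  have hW := hR.posSemidef.transpose_mul_mul_same K
  have h : P.PosSemidef := posSemidef_of_stein hK.tendsto_pow
    (W := Kᵀ * R * K + Q) (by rw [← add_assoc]; exact hP) (hW.add hQ.posSemidef)
  rw [← hP]
  exact Matrix.PosDef.posSemidef_add ((h.transpose_mul_mul_same _).add hW) hQ

theorem IsCostMatrix.completion (hR : Rᵀ = R) (hPt : Pᵀ = P) (hP : IsCostMatrix A Q B R K P)
    (D : Matrix (Fin m) (Fin n) ℝ) :
    (A - B * (K + D))ᵀ * P * (A - B * (K + D)) + (K + D)ᵀ * R * (K + D) + Q =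
      P + (Dᵀ * natGrad A B R K P + (natGrad A B R K P)ᵀ * D + Dᵀ * (R + Bᵀ * P * B) * D) := by
  unfold IsCostMatrix at hP
  unfold natGrad
  nth_rewrite 2 [← hP]
  have h : A - B * (K + D) = (A - B * K) - B * D := by
    rw [Matrix.mul_add]; abel
  rw [h]
  generalize A - B * K = L
  simp only [Matrix.transpose_sub, Matrix.transpose_add, Matrix.transpose_mul, hR, hPt,
    Matrix.transpose_transpose, Matrix.mul_add, Matrix.add_mul, Matrix.mul_sub, Matrix.sub_mul,
    Matrix.mul_assoc]
  abel

theorem IsCostMatrix.sub_eq (hR : Rᵀ = R) (hPt : Pᵀ = P) (hP : IsCostMatrix A Q B R K P)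
    (hP' : IsCostMatrix A Q B R K' P') :
    (A - B * K')ᵀ * (P - P') * (A - B * K') + -((K' - K)ᵀ * natGrad A B R K P +
      (natGrad A B R K P)ᵀ * (K' - K) + (K' - K)ᵀ * (R + Bᵀ * P * B) * (K' - K)) = P - P' := by
  have h := hP.completion hR hPt (K' - K)
  rw [add_sub_cancel] at h
  unfold IsCostMatrix at hP'
  nth_rewrite 2 [← hP']
  rw [Matrix.mul_sub (A - B * K')ᵀ, Matrix.sub_mul _ _ (A - B * K'), ← sub_eq_zero]
  rw [← sub_eq_zero] at h
  rw [← h]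
  abel

theorem posSemidef_step_decrease {S : Matrix (Fin m) (Fin m) ℝ} (hS : S.IsHermitian)
    (hpos : 0 < eigMax S) (G : Matrix (Fin m) (Fin n) ℝ) :
    (-((-(1 / eigMax S) • G)ᵀ * G + Gᵀ * (-(1 / eigMax S) • G) +
      (-(1 / eigMax S) • G)ᵀ * S * (-(1 / eigMax S) • G)) -
      (1 / eigMax S) • (Gᵀ * G)).PosSemidef := by
  have h := ((posSemidef_eigMax_smul_one_sub hS).transpose_mul_mul_same G).smul
    (sq_nonneg (1 / eigMax S))
  convert h using 1
  simp only [Matrix.transpose_smul, Matrix.smul_mul, Matrix.mul_smul, Matrix.mul_sub,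
    Matrix.sub_mul, Matrix.mul_one, smul_sub, smul_smul]
  have : (1 / eigMax S) ^ 2 * eigMax S = 1 / eigMax S := by field_simp
  rw [this]
  module

/-- The Hessian weight `R + Bᵀ P B` is positive definite. -/
theorem posDef_weight (hR : R.PosDef) (hP : P.PosSemidef) : (R + Bᵀ * P * B).PosDef :=
  hR.add_posSemidef (hP.transpose_mul_mul_same B)

theorem IsCostMatrix.isSchur_step (hm : 0 < m) (hQ : Q.PosDef) (hR : R.PosDef)
    (hK : IsSchur (A - B * K)) (hP : IsCostMatrix A Q B R K P)
    (hK' : K' = K - (1 / eigMax (R + Bᵀ * P * B)) • natGrad A B R K P) :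
    IsSchur (A - B * K') := by
  have hPD := hP.posDef hQ hR hK
  have hS := posDef_weight (B := B) hR hPD.posSemidef
  have hW := posSemidef_step_decrease hS.1 (eigMax_pos hm hS) (natGrad A B R K P)
  have hG := (Matrix.posSemidef_transpose_mul_self (natGrad A B R K P)).smul
    (one_div_pos.mpr (eigMax_pos hm hS)).le
  have hc := hP.completion hR.transpose_eq hPD.transpose_eq
    (-(1 / eigMax (R + Bᵀ * P * B)) • natGrad A B R K P)
  have hK2 : K + -(1 / eigMax (R + Bᵀ * P * B)) • natGrad A B R K P = K' := by
    rw [hK', neg_smul, sub_eq_add_neg]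
  rw [hK2] at hc
  refine isSchur_of_lyapunov hPD.posSemidef ?_
  convert Matrix.PosDef.posSemidef_add
    ((hW.add hG).add (hR.posSemidef.transpose_mul_mul_same K')) hQ using 1
  rw [← sub_eq_zero] at hc ⊢
  rw [← neg_eq_zero, ← hc]
  abel

theorem IsCostMatrix.posSemidef_sub_step (hm : 0 < m) (hQ : Q.PosDef) (hR : R.PosDef)
    (hK : IsSchur (A - B * K)) (hP : IsCostMatrix A Q B R K P)
    (hK' : K' = K - (1 / eigMax (R + Bᵀ * P * B)) • natGrad A B R K P)
    (hP' : IsCostMatrix A Q B R K' P') :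
    (P - P' - (1 / eigMax (R + Bᵀ * P * B)) •
      ((natGrad A B R K P)ᵀ * natGrad A B R K P)).PosSemidef := by
  have hPD := hP.posDef hQ hR hK
  have hS := posDef_weight (B := B) hR hPD.posSemidef
  have hW := posSemidef_step_decrease hS.1 (eigMax_pos hm hS) (natGrad A B R K P)
  have hG := (Matrix.posSemidef_transpose_mul_self (natGrad A B R K P)).smul
    (one_div_pos.mpr (eigMax_pos hm hS)).le
  have heq := hP.sub_eq hR.transpose_eq hPD.transpose_eq hP'
  have hd : K' - K = -(1 / eigMax (R + Bᵀ * P * B)) • natGrad A B R K P := by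
    rw [hK', neg_smul]; abel
  rw [hd] at heq
  have hD : (P - P').PosSemidef := by
    refine posSemidef_of_stein (hP.isSchur_step hm hQ hR hK hK').tendsto_pow heq ?_
    simpa using hW.add hG
  convert hW.add (hD.transpose_mul_mul_same (A - B * K')) using 1
  nth_rewrite 1 [← heq]
  abel

/-- Gradient dominance. -/
theorem IsCostMatrix.trace_sub_le {r c : ℝ} {T Y : Matrix (Fin n) (Fin n) ℝ} (hQ : Q.PosDef)
    (hR : R.PosDef) (hr : 0 < r) (hRr : (R - r • (1 : Matrix (Fin m) (Fin m) ℝ)).PosSemidef)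
    (hK : IsSchur (A - B * K)) (hP : IsCostMatrix A Q B R K P)
    (hP' : IsCostMatrix A Q B R K' P') (hYpos : Y.PosSemidef)
    (hY : (A - B * K') * Y * (A - B * K')ᵀ + T = Y) (hYc : (c • T - Y).PosSemidef) :
    (P * T).trace - (P' * T).trace ≤
      c / r * ((natGrad A B R K P)ᵀ * natGrad A B R K P * T).trace := by
  have hPD := hP.posDef hQ hR hK
  have heq := hP.sub_eq hR.transpose_eq hPD.transpose_eq hP'
  set G := natGrad A B R K P
  set D := K' - K
  set W := -(Dᵀ * G + Gᵀ * D + Dᵀ * (R + Bᵀ * P * B) * D)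
  have hWle : (r⁻¹ • (Gᵀ * G) - W).PosSemidef := by
    convert ((Matrix.posSemidef_transpose_mul_self (G + r • D)).smul (inv_pos.mpr hr).le).add
      ((hRr.add (hPD.posSemidef.transpose_mul_mul_same B)).transpose_mul_mul_same D) using 1
    simp only [W, Matrix.transpose_add, Matrix.transpose_smul, Matrix.smul_mul, Matrix.mul_smul,
      Matrix.mul_add, Matrix.add_mul, Matrix.mul_sub, Matrix.sub_mul, Matrix.mul_one, smul_add,
      smul_smul, inv_mul_cancel₀ hr.ne', ← mul_assoc, one_mul, one_smul]
    abel
  have htr : ((P - P') * T).trace = (W * Y).trace := by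
    have hT : T = Y - (A - B * K') * Y * (A - B * K')ᵀ := eq_sub_of_add_eq' hY
    have hW' : W = (P - P') - (A - B * K')ᵀ * (P - P') * (A - B * K') := eq_sub_of_add_eq' heq
    rw [hT, hW']
    generalize P - P' = E
    generalize A - B * K' = L
    rw [Matrix.mul_sub, Matrix.sub_mul, Matrix.trace_sub, Matrix.trace_sub]
    congr 1
    rw [Matrix.mul_assoc Lᵀ, Matrix.mul_assoc Lᵀ, Matrix.trace_mul_comm Lᵀ]
    simp only [Matrix.mul_assoc]
  have h1 := hWle.trace_mul_nonneg hYpos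
  have h2 := (Matrix.posSemidef_transpose_mul_self G).trace_mul_nonneg hYc
  rw [Matrix.sub_mul, Matrix.trace_sub, Matrix.smul_mul, Matrix.trace_smul, smul_eq_mul] at h1
  rw [Matrix.mul_sub, Matrix.trace_sub, Matrix.mul_smul, Matrix.trace_smul, smul_eq_mul] at h2
  rw [Matrix.sub_mul, Matrix.trace_sub] at htr
  rw [htr]
  calc (W * Y).trace ≤ r⁻¹ * (Gᵀ * G * Y).trace := by linarith
    _ ≤ r⁻¹ * (c * (Gᵀ * G * T).trace) := by gcongr; linarith
    _ = _ := by ring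

theorem frobNorm_sq_eq_trace (D : Matrix (Fin m) (Fin n) ℝ) :
    frobNorm D ^ 2 = (Dᵀ * D).trace := by
  rw [frobNorm, Real.sq_sqrt (by positivity), Finset.sum_comm]
  simp [Matrix.trace, Matrix.mul_apply, sq]

theorem smul_frobNorm_sq_le_trace {s : ℝ} {T : Matrix (Fin n) (Fin n) ℝ}
    (hT : (T - s • (1 : Matrix (Fin n) (Fin n) ℝ)).PosSemidef) (D : Matrix (Fin m) (Fin n) ℝ) :
    s * frobNorm D ^ 2 ≤ (Dᵀ * D * T).trace := by
  have h := (Matrix.posSemidef_transpose_mul_self D).trace_mul_nonneg hT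
  rw [Matrix.mul_sub, Matrix.trace_sub, Matrix.mul_smul, Matrix.mul_one, Matrix.trace_smul,
    smul_eq_mul] at h
  rw [frobNorm_sq_eq_trace]
  linarith

/-- Quadratic growth around a stationary gain. -/
theorem IsCostMatrix.growth {r s : ℝ} {T : Matrix (Fin n) (Fin n) ℝ} (hQ : Q.PosDef)
    (hR : R.PosDef) (hr : 0 < r) (hRr : (R - r • (1 : Matrix (Fin m) (Fin m) ℝ)).PosSemidef)
    (hT : T.PosSemidef) (hTs : (T - s • (1 : Matrix (Fin n) (Fin n) ℝ)).PosSemidef)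
    (hK : IsSchur (A - B * K)) (hP : IsCostMatrix A Q B R K P) (hG : natGrad A B R K P = 0)
    (hK' : IsSchur (A - B * K')) (hP' : IsCostMatrix A Q B R K' P') :
    r * s * frobNorm (K' - K) ^ 2 ≤ (P' * T).trace - (P * T).trace := by
  have hPD := hP.posDef hQ hR hK
  have heq := hP.sub_eq hR.transpose_eq hPD.transpose_eq hP'
  rw [hG] at heq
  simp only [Matrix.mul_zero, Matrix.transpose_zero, Matrix.zero_mul, zero_add] at heq
  set D := K' - K
  have hW : (Dᵀ * (R + Bᵀ * P * B) * D).PosSemidef :=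
    (posDef_weight hR hPD.posSemidef).posSemidef.transpose_mul_mul_same D
  have heq' : (A - B * K')ᵀ * (P' - P) * (A - B * K') + Dᵀ * (R + Bᵀ * P * B) * D = P' - P := by
    rw [← neg_sub P P', ← heq]
    nth_rewrite 1 [heq]
    rw [Matrix.mul_neg, Matrix.neg_mul]
    abel
  have hE := posSemidef_of_stein hK'.tendsto_pow heq' hW
  have h : (P' - P - r • (Dᵀ * D)).PosSemidef := by
    convert (hE.transpose_mul_mul_same (A - B * K')).add
      ((hRr.add (hPD.posSemidef.transpose_mul_mul_same B)).transpose_mul_mul_same D) using 1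
    nth_rewrite 1 [← heq']
    simp only [Matrix.mul_add, Matrix.add_mul, Matrix.mul_sub, Matrix.sub_mul, Matrix.mul_smul,
      Matrix.smul_mul, Matrix.mul_one]
    abel
  have h1 := h.trace_mul_nonneg hT
  rw [Matrix.sub_mul, Matrix.sub_mul, Matrix.trace_sub, Matrix.trace_sub, Matrix.smul_mul,
    Matrix.trace_smul, smul_eq_mul] at h1
  have h2 := smul_frobNorm_sq_le_trace hTs D
  nlinarith

/-- A minimizing gain is stationary. -/
theorem IsCostMatrix.natGrad_eq_zero {T : Matrix (Fin n) (Fin n) ℝ} (hm : 0 < m) (hQ : Q.PosDef)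
    (hR : R.PosDef) (hT : T.PosDef) (hK : IsSchur (A - B * K)) (hP : IsCostMatrix A Q B R K P)
    (hK' : K' = K - (1 / eigMax (R + Bᵀ * P * B)) • natGrad A B R K P)
    (hP' : IsCostMatrix A Q B R K' P') (hle : (P * T).trace ≤ (P' * T).trace) :
    natGrad A B R K P = 0 := by
  have hPD := hP.posDef hQ hR hK
  have hpos := one_div_pos.mpr (eigMax_pos hm (posDef_weight (B := B) hR hPD.posSemidef))
  have h := (hP.posSemidef_sub_step hm hQ hR hK hK' hP').trace_mul_nonneg hT.posSemidef
  obtain ⟨s, hs, hTs⟩ := hT.exists_smul_one_le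
  have h2 := smul_frobNorm_sq_le_trace hTs (natGrad A B R K P)
  rw [Matrix.sub_mul, Matrix.sub_mul, Matrix.trace_sub, Matrix.trace_sub, Matrix.smul_mul,
    Matrix.trace_smul, smul_eq_mul] at h
  have h3 : ((natGrad A B R K P)ᵀ * natGrad A B R K P * T).trace ≤ 0 :=
    nonpos_of_mul_nonpos_right (by linarith) hpos
  have h4 : frobNorm (natGrad A B R K P) ^ 2 = 0 :=
    le_antisymm (nonpos_of_mul_nonpos_right (h2.trans h3) hs) (sq_nonneg _)
  rw [frobNorm_sq_eq_trace] at h4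
  simpa using Matrix.trace_conjTranspose_mul_self_eq_zero_iff.mp
    (by simpa using h4 : ((natGrad A B R K P)ᴴ * natGrad A B R K P).trace = 0)

end LQR

theorem stmt16 {n m : ℕ} (hn : 0 < n) (hm : 0 < m)
    (A : Matrix (Fin n) (Fin n) ℝ) (B : Matrix (Fin n) (Fin m) ℝ)
    (Q Sig : Matrix (Fin n) (Fin n) ℝ) (R : Matrix (Fin m) (Fin m) ℝ)
    (hQ : Q.PosDef) (hR : R.PosDef) (hSig : Sig.PosDef)
    (X : Matrix (Fin m) (Fin n) ℝ → Matrix (Fin n) (Fin n) ℝ)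
    (Y : Matrix (Fin m) (Fin n) ℝ → Matrix (Fin n) (Fin n) ℝ)
    (hX : ∀ K, IsSchur (A - B * K) →
      (A - B * K)ᵀ * X K * (A - B * K) + Kᵀ * R * K + Q = X K)
    (hY : ∀ K, IsSchur (A - B * K) →
      (A - B * K) * Y K * (A - B * K)ᵀ + Sig = Y K)
    -- `Kstar` is the global minimizer of `f` over `S`
    (Kstar : Matrix (Fin m) (Fin n) ℝ) (hKstar : IsSchur (A - B * Kstar))
    (hmin : ∀ K, IsSchur (A - B * K) →
      Matrix.trace (X Kstar * Sig) ≤ Matrix.trace (X K * Sig))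
    -- the natural gradient descent iterates
    (K₀ : Matrix (Fin m) (Fin n) ℝ) (hK₀ : IsSchur (A - B * K₀))
    (Kseq : ℕ → Matrix (Fin m) (Fin n) ℝ) (hK0 : Kseq 0 = K₀)
    (Mseq : ℕ → Matrix (Fin m) (Fin n) ℝ)
    (hM : ∀ j, Mseq j = R * Kseq j - Bᵀ * X (Kseq j) * (A - B * Kseq j))
    (η : ℕ → ℝ) (hη : ∀ j, η j = 1 / (2 * eigMax (R + Bᵀ * X (Kseq j) * B)))
    (hrec : ∀ j, Kseq (j + 1) = Kseq j - (2 * η j) • Mseq j) :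
    (∀ j, IsSchur (A - B * Kseq j)) ∧
    (∀ j, (X (Kseq j) - X (Kseq (j + 1))).PosSemidef) ∧
    ∃ q₀ ∈ Set.Ioo (0 : ℝ) 1, ∃ c₂ > (0 : ℝ), ∀ j : ℕ,
      Matrix.trace (X (Kseq j) * Sig) - Matrix.trace (X Kstar * Sig)
          ≤ q₀ ^ j * (Matrix.trace (X K₀ * Sig) - Matrix.trace (X Kstar * Sig)) ∧
      frobNorm (Kseq j - Kstar) ≤ c₂ * q₀ ^ ((j : ℝ) / 2) := by
  have hcost : ∀ K, IsSchur (A - B * K) → IsCostMatrix A Q B R K (X K) := hX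
  have hstep : ∀ j, Kseq (j + 1) = Kseq j -
      (1 / eigMax (R + Bᵀ * X (Kseq j) * B)) • natGrad A B R (Kseq j) (X (Kseq j)) := by
    intro j
    rw [hrec, hM, hη, natGrad]
    congr 2
    ring
  have hstab : ∀ j, IsSchur (A - B * Kseq j) := by
    intro j
    induction j with
    | zero => rwa [hK0]
    | succ j ih => exact (hcost _ ih).isSchur_step hm hQ hR ih (hstep j)
  have hPD : ∀ j, (X (Kseq j)).PosDef := fun j => (hcost _ (hstab j)).posDef hQ hR (hstab j)
  have hS : ∀ j, (R + Bᵀ * X (Kseq j) * B).PosDef := fun j => posDef_weight hR (hPD j).posSemidef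
  have hdec := fun j => (hcost _ (hstab j)).posSemidef_sub_step hm hQ hR (hstab j) (hstep j)
    (hcost _ (hstab (j + 1)))
  have hmono : ∀ j, (X (Kseq j) - X (Kseq (j + 1))).PosSemidef := by
    intro j
    simpa using (hdec j).add ((Matrix.posSemidef_transpose_mul_self
      (natGrad A B R (Kseq j) (X (Kseq j)))).smul (one_div_pos.mpr (eigMax_pos hm (hS j))).le)
  refine ⟨hstab, hmono, ?_⟩
  have hle0 : ∀ j, (X (Kseq 0) - X (Kseq j)).PosSemidef := by
    intro j
    induction j with
    | zero => simpa using Matrix.PosSemidef.zero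
    | succ j ih => simpa using ih.add (hmono j)
  have ht : ∀ j, 1 / eigMax (R + Bᵀ * X (Kseq 0) * B) ≤ 1 / eigMax (R + Bᵀ * X (Kseq j) * B) := by
    intro j
    refine one_div_le_one_div_of_le (eigMax_pos hm (hS j)) (eigMax_mono hm (hS j).1 (hS 0).1 ?_)
    convert (hle0 j).transpose_mul_mul_same B using 1
    rw [Matrix.mul_sub, Matrix.sub_mul]
    abel
  have ht0 := one_div_pos.mpr (eigMax_pos hm (hS 0))
  set t := 1 / eigMax (R + Bᵀ * X (Kseq 0) * B)
  obtain ⟨r, hr, hRr⟩ := hR.exists_smul_one_le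
  obtain ⟨s, hs, hSs⟩ := hSig.exists_smul_one_le
  have hYstar : (Y Kstar).PosSemidef := by
    refine posSemidef_of_stein (L := (A - B * Kstar)ᵀ) ?_ ?_ hSig.posSemidef
    · have h := (continuous_id.matrix_transpose.tendsto
        (0 : Matrix (Fin n) (Fin n) ℝ)).comp hKstar.tendsto_pow
      simpa [Function.comp_def, Matrix.transpose_pow] using h
    · rw [Matrix.transpose_transpose]
      exact hY _ hKstar
  obtain ⟨C, hC, hCY⟩ := hSig.exists_le_smul hYstar.1
  set g : ℕ → ℝ := fun j => ((natGrad A B R (Kseq j) (X (Kseq j)))ᵀ *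
    natGrad A B R (Kseq j) (X (Kseq j)) * Sig).trace with hg
  set a : ℕ → ℝ := fun j => (X (Kseq j) * Sig).trace - (X Kstar * Sig).trace with ha
  have hg0 : ∀ j, 0 ≤ g j := fun j =>
    (Matrix.posSemidef_transpose_mul_self _).trace_mul_nonneg hSig.posSemidef
  have hdom : ∀ j, a j ≤ C / r * g j := fun j => (hcost _ (hstab j)).trace_sub_le hQ hR hr hRr
    (hstab j) (hcost _ hKstar) hYstar (hY _ hKstar) hCY
  have ha_step : ∀ j, a (j + 1) ≤ a j - t * g j := by
    intro j
    have h := (hdec j).trace_mul_nonneg hSig.posSemidef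
    rw [Matrix.sub_mul, Matrix.sub_mul, Matrix.trace_sub, Matrix.trace_sub, Matrix.smul_mul,
      Matrix.trace_smul, smul_eq_mul] at h
    have h2 := mul_le_mul_of_nonneg_right (ht j) (hg0 j)
    simp only [ha, hg] at h2 ⊢
    linarith
  have hCr : 0 < C / r := div_pos hC hr
  have hden : 0 < C / r + t := by positivity
  have hq : 1 - t / (C / r + t) = C / r / (C / r + t) := by
    field_simp
    ring
  have hq0 : 0 < 1 - t / (C / r + t) := by rw [hq]; positivity
  have hq1 : 1 - t / (C / r + t) < 1 := sub_lt_self _ (by positivity)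
  have hcontr : ∀ j, a (j + 1) ≤ (1 - t / (C / r + t)) * a j := by
    intro j
    have h : t / (C / r + t) * a j ≤ t * g j := by
      rw [div_mul_eq_mul_div, div_le_iff₀ hden]
      nlinarith [mul_le_mul_of_nonneg_left (hdom j) ht0.le, mul_nonneg ht0.le
        (mul_nonneg ht0.le (hg0 j))]
    linarith [ha_step j]
  set q := 1 - t / (C / r + t)
  have hrate : ∀ j, a j ≤ q ^ j * a 0 := by
    intro j
    induction j with
    | zero => simp
    | succ j ih =>
      calc a (j + 1) ≤ q * a j := hcontr j
        _ ≤ q * (q ^ j * a 0) := by gcongr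
        _ = q ^ (j + 1) * a 0 := by ring
  have ha0 : 0 ≤ a 0 := sub_nonneg.mpr (hmin _ (hstab 0))
  have hGstar : natGrad A B R Kstar (X Kstar) = 0 := by
    have h := (hcost _ hKstar).isSchur_step hm hQ hR hKstar rfl
    exact (hcost _ hKstar).natGrad_eq_zero hm hQ hR hSig hKstar rfl (hcost _ h) (hmin _ h)
  have hgrow : ∀ j, r * s * frobNorm (Kseq j - Kstar) ^ 2 ≤ a j := fun j =>
    (hcost _ hKstar).growth hQ hR hr hRr hSig.posSemidef hSs hKstar hGstar (hstab j)
      (hcost _ (hstab j))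
  refine ⟨q, ⟨hq0, hq1⟩, √(a 0 / (r * s)) + 1, by positivity, fun j => ⟨?_, ?_⟩⟩
  · rw [← hK0]
    exact hrate j
  · have hqj : (q ^ ((j : ℝ) / 2)) ^ 2 = q ^ j := by
      rw [← Real.rpow_natCast, ← Real.rpow_mul hq0.le]
      simp
    have hqpos : 0 < q ^ ((j : ℝ) / 2) := Real.rpow_pos_of_pos hq0 _
    have hbound : frobNorm (Kseq j - Kstar) ≤ √(a 0 / (r * s)) * q ^ ((j : ℝ) / 2) := by
      refine le_of_abs_le (abs_le_of_sq_le_sq ?_ (by positivity))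
      rw [mul_pow, hqj, Real.sq_sqrt (by positivity), div_mul_eq_mul_div,
        le_div_iff₀ (by positivity)]
      linarith [hgrow j, hrate j]
    linarith
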